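/- arXiv:2310.05788 — 3 statements merged into one kernel-verified Lean document; each statement's English description precedes it below -/
import Mathlib

section
/- Let n be a positive integer and S ⊆ Z_n \ {0} with S = −S, so that Cay(Z_n,S) is an undirected circulant graph. Then the walk matrix W_0 of Cay(Z_n,S) has the maximum possible rank ⌈(n+1)/2⌉ over ℂ if and only if Cay(Z_n,S) has saturated spectrum, i.e., |{λ_{a,S} : a ∈ Z_n}| = ⌈(n+1)/2⌉. -/
/-- `ζ_n = exp(-2πi/n)`. -/
noncomputable def zetaC (n : ℕ) : ℂ := Complex.exp (-(2 * Real.pi * Complex.I) / n)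

/-- The adjacency matrix of the Cayley digraph `Cay(Z_n, S)`. -/
noncomputable def cayAdj (n : ℕ) (S : Finset (ZMod n)) : Matrix (ZMod n) (ZMod n) ℂ :=
  fun x y => if y - x ∈ S then 1 else 0

/-- The eigenvalue `λ_{a,S} = ∑_{j ∈ S} ζ_n^{a·j}` of `Cay(Z_n, S)`. -/
noncomputable def cayEig (n : ℕ) (S : Finset (ZMod n)) (a : ZMod n) : ℂ :=
  ∑ j ∈ S, zetaC n ^ (a * j).val

/-- The walk matrix `W_0` of `Cay(Z_n, S)` with vertex `0` individualized:
its `(x,k)` entry is the number of walks of length `k` from `x` to `0`,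
i.e. `(A^k)_{x,0}`. -/
noncomputable def walkMatrix (n : ℕ) [NeZero n] (S : Finset (ZMod n)) :
    Matrix (ZMod n) (ZMod n) ℂ :=
  fun x k => (cayAdj n S ^ k.val) x 0

open Finset Matrix

/-- Rows of powers of distinct scalars are linearly independent as soon as the exponents include
all `i` below the number of scalars. -/
theorem linearIndepOn_pow_of_exponents {K κ : Type*} [Field K] [DecidableEq K] (T : Finset K)
    (e : κ → ℕ) (he : ∀ i < #T, ∃ k, e k = i) :
    LinearIndepOn K (fun (x : K) (k : κ) => x ^ e k) (T : Set K) := by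
  rw [linearIndepOn_finset_iff]
  intro g hg x hx
  have hpow : ∀ i < #T, ∑ y ∈ T, g y * y ^ i = 0 := by
    intro i hi
    obtain ⟨k, rfl⟩ := he i hi
    simpa using congrFun hg k
  have hpoly : ∀ p : Polynomial K, p.natDegree < #T → ∑ y ∈ T, g y * p.eval y = 0 := by
    intro p hp
    simp_rw [Polynomial.eval_eq_sum_range, mul_sum]
    rw [sum_comm]
    refine sum_eq_zero fun i hi => ?_
    simp_rw [mul_left_comm (g _) (p.coeff i), ← mul_sum]
    rw [hpow i (by rw [mem_range] at hi; omega), mul_zero]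
  have hinj : Set.InjOn (id : K → K) T := Set.injOn_id _
  have hdeg : (Lagrange.basis T id x).natDegree < #T := by
    have := Polynomial.natDegree_eq_of_degree_eq_some (Lagrange.degree_basis hinj hx)
    have := card_pos.mpr ⟨x, hx⟩
    omega
  have hsum := hpoly _ hdeg
  rw [sum_eq_single_of_mem x hx] at hsum
  · simpa [show (Lagrange.basis T id x).eval x = 1 from Lagrange.eval_basis_self hinj hx]
      using hsum
  · intro y hy hyx
    rw [show (Lagrange.basis T id x).eval y = 0 from
      Lagrange.eval_basis_of_ne (v := id) hyx.symm hy, mul_zero]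

/-- A generalized Vandermonde matrix with enough exponents has rank the number of distinct nodes. -/
theorem rank_pow_eq_card_image {K ι κ : Type*} [Field K] [DecidableEq K] [Fintype ι] [Fintype κ]
    (f : ι → K) (e : κ → ℕ) (he : ∀ i < #(univ.image f), ∃ k, e k = i) :
    (Matrix.of fun (i : ι) (k : κ) => f i ^ e k).rank = #(univ.image f) := by
  have hli := linearIndepOn_pow_of_exponents (univ.image f) e he
  have hrow : Set.range (Matrix.of fun (i : ι) (k : κ) => f i ^ e k).row =
      Set.range fun x : (univ.image f : Finset K) => fun k : κ => (x : K) ^ e k := by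
    ext v
    simp only [Set.mem_range, Subtype.exists, mem_image, mem_univ, true_and, exists_prop,
      exists_exists_eq_and]
    rfl
  rw [Matrix.rank_eq_finrank_span_row, hrow]
  exact (finrank_span_eq_card hli).trans (Fintype.card_coe _)

/-- The Fourier matrix of `Z_n`, with entries `ζ_n^{x·a}`. -/
noncomputable def fourierMatrix (n : ℕ) [NeZero n] : Matrix (ZMod n) (ZMod n) ℂ :=
  Matrix.of fun x a => ZMod.stdAddChar (-(x * a))

theorem zetaC_pow_val (n : ℕ) [NeZero n] (a : ZMod n) :
    zetaC n ^ a.val = ZMod.stdAddChar (-a) := by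
  rw [AddChar.map_neg_eq_inv, ZMod.stdAddChar_apply, ZMod.toCircle_apply, zetaC,
    ← Complex.exp_nat_mul, ← Complex.exp_neg]
  congr 1
  ring

theorem cayEig_eq_sum_stdAddChar (n : ℕ) [NeZero n] (S : Finset (ZMod n)) (a : ZMod n) :
    cayEig n S a = ∑ j ∈ S, ZMod.stdAddChar (-(a * j)) := by
  simp [cayEig, zetaC_pow_val]

theorem sum_stdAddChar_mul (n : ℕ) [NeZero n] (b : ZMod n) :
    ∑ a : ZMod n, (ZMod.stdAddChar (a * b) : ℂ) = if b = 0 then (n : ℂ) else 0 := by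
  rw [AddChar.sum_mulShift b (ZMod.isPrimitive_stdAddChar n), ZMod.card]
  split_ifs <;> simp

theorem isUnit_det_fourierMatrix (n : ℕ) [NeZero n] : IsUnit (fourierMatrix n).det := by
  have hn : (n : ℂ) ≠ 0 := NeZero.ne _
  refine Matrix.isUnit_det_of_right_inverse
    (B := (n : ℂ)⁻¹ • Matrix.of fun a x : ZMod n => (ZMod.stdAddChar (a * x) : ℂ)) ?_
  ext x y
  have hterm (a : ZMod n) : (ZMod.stdAddChar (-(x * a)) : ℂ) * ZMod.stdAddChar (a * y) =
      ZMod.stdAddChar (a * (y - x)) := by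
    rw [← AddChar.map_add_eq_mul]
    congr 1
    ring
  rw [Matrix.mul_smul, Matrix.smul_apply, Matrix.mul_apply]
  simp only [fourierMatrix, Matrix.of_apply, hterm, sum_stdAddChar_mul, sub_eq_zero,
    Matrix.one_apply, eq_comm (a := y)]
  split_ifs <;> simp [hn]

theorem cayAdj_mul_fourierMatrix (n : ℕ) [NeZero n] (S : Finset (ZMod n)) :
    cayAdj n S * fourierMatrix n = fourierMatrix n * diagonal (cayEig n S) := by
  ext x a
  rw [Matrix.mul_diagonal, Matrix.mul_apply, cayEig_eq_sum_stdAddChar, mul_sum,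
    ← Equiv.sum_comp (Equiv.addRight x)]
  simp only [cayAdj, Equiv.coe_addRight, add_sub_cancel_right, ite_mul, one_mul, zero_mul,
    sum_ite_mem, univ_inter, fourierMatrix, Matrix.of_apply]
  refine sum_congr rfl fun j _ => ?_
  rw [← AddChar.map_add_eq_mul]
  congr 1
  ring

theorem cayAdj_pow_mul_fourierMatrix (n : ℕ) [NeZero n] (S : Finset (ZMod n)) (k : ℕ) :
    cayAdj n S ^ k * fourierMatrix n = fourierMatrix n * diagonal (cayEig n S ^ k) := by
  rw [← Matrix.diagonal_pow]
  exact (SemiconjBy.pow_right (show SemiconjBy (fourierMatrix n) (diagonal (cayEig n S))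
    (cayAdj n S) from (cayAdj_mul_fourierMatrix n S).symm) k).symm

theorem walkMatrix_eq_fourierMatrix_mul (n : ℕ) [NeZero n] (S : Finset (ZMod n)) :
    (n : ℂ) • walkMatrix n S =
      fourierMatrix n * Matrix.of fun a k : ZMod n => cayEig n S a ^ k.val := by
  ext x k
  have h := congrArg (fun M => (M *ᵥ 1) x) (cayAdj_pow_mul_fourierMatrix n S k.val)
  have hone : fourierMatrix n *ᵥ 1 = Pi.single 0 (n : ℂ) := by
    ext y
    simpa [Matrix.mulVec, dotProduct, fourierMatrix, mul_comm y, Pi.single_apply]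
      using sum_stdAddChar_mul n (-y)
  simp only [← Matrix.mulVec_mulVec, hone] at h
  simpa [walkMatrix, Matrix.mul_apply, Matrix.mulVec, dotProduct, Matrix.mulVec_single,
    Pi.single_apply, Matrix.diagonal_apply, mul_comm] using h

/-- The rank of the walk matrix is the number of distinct eigenvalues. -/
theorem rank_walkMatrix (n : ℕ) [NeZero n] (S : Finset (ZMod n)) :
    (walkMatrix n S).rank = #(univ.image (cayEig n S)) := by
  have hn : IsUnit (n : ℂ) := (NeZero.ne (n : ℂ)).isUnit
  have hcard : #(univ.image (cayEig n S)) ≤ n := card_image_le.trans_eq (by simp [ZMod.card])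
  rw [← Matrix.rank_smul_of_mem_nonZeroDivisors _ hn.mem_nonZeroDivisors,
    walkMatrix_eq_fourierMatrix_mul,
    Matrix.rank_mul_eq_right_of_isUnit_det _ _ (isUnit_det_fourierMatrix n)]
  exact rank_pow_eq_card_image (cayEig n S) ZMod.val fun i hi =>
    ⟨i, ZMod.val_natCast_of_lt (hi.trans_le hcard)⟩

/-- For an undirected circulant graph `Cay(Z_n,S)` (i.e. `S = -S`), the walk matrix
`W_0` has the maximum possible rank `⌈(n+1)/2⌉` iff the graph has saturated spectrum,
i.e. exactly `⌈(n+1)/2⌉` distinct eigenvalues.  (Note `⌈(n+1)/2⌉ = (n+2)/2` in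
natural-number division.) -/
theorem stmt2 (n : ℕ) [NeZero n] (S : Finset (ZMod n)) (hS : (0 : ZMod n) ∉ S)
    (hsym : ∀ x : ZMod n, x ∈ S ↔ -x ∈ S) :
    (walkMatrix n S).rank = (n + 2) / 2 ↔
      (Finset.image (cayEig n S) Finset.univ).card = (n + 2) / 2 := by
  rw [rank_walkMatrix]
end

section
/- For every ε > 0 there exists N such that for all n ≥ N: the number of subsets S ⊆ Z_n \ {0} for which the n values λ_{a,S} (a ∈ Z_n) are NOT pairwise distinct is at most n^{−1/2+ε}·2^{n−1}. Equivalently, if S ⊆ Z_n \ {0} is chosen uniformly at random, the Cayley digraph Cay(Z_n,S) has simple spectrum with probability at least 1 − n^{−1/2+ε}. -/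
section

open Finset

theorem centralBinom_sq_mul_le (k : ℕ) : k.centralBinom ^ 2 * (2 * k + 1) ≤ 16 ^ k := by
  induction k with
  | zero => simp
  | succ k ih =>
    have h := Nat.succ_mul_centralBinom_succ k
    refine le_of_mul_le_mul_left ?_ (show 0 < (k + 1) ^ 2 by positivity)
    calc (k + 1) ^ 2 * ((k + 1).centralBinom ^ 2 * (2 * (k + 1) + 1))
        = ((k + 1) * (k + 1).centralBinom) ^ 2 * (2 * k + 3) := by ring
      _ = (k.centralBinom ^ 2 * (2 * k + 1)) * (4 * ((2 * k + 1) * (2 * k + 3))) := by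
        rw [h]; ring
      _ ≤ 16 ^ k * (4 * ((2 * k + 1) * (2 * k + 3))) := by gcongr
      _ ≤ 16 ^ k * (16 * (k + 1) ^ 2) := by
        exact Nat.mul_le_mul_left _ (by nlinarith)
      _ = (k + 1) ^ 2 * 16 ^ (k + 1) := by ring

theorem choose_half_sq_mul_le (m : ℕ) : (m.choose (m / 2)) ^ 2 * (m + 1) ≤ 4 ^ m := by
  obtain ⟨k, rfl | rfl⟩ := m.even_or_odd'
  · have h := centralBinom_sq_mul_le k
    rw [pow_mul, Nat.mul_div_cancel_left k two_pos]
    exact h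
  · have h := centralBinom_sq_mul_le (k + 1)
    have h2 : (k + 1).centralBinom = 2 * (2 * k + 1).choose k := by
      rw [Nat.centralBinom, show 2 * (k + 1) = (2 * k + 1) + 1 by ring, Nat.choose_succ_succ,
        Nat.choose_symm_half]
      ring
    rw [h2] at h
    rw [show (2 * k + 1) / 2 = k by omega]
    have h4 : 4 ^ (2 * k + 1) * 4 = 16 ^ (k + 1) := by
      rw [pow_succ, pow_mul, pow_succ]; ring
    nlinarith [Nat.zero_le (((2 * k + 1).choose k) ^ 2)]

/-- The Erdős–Littlewood–Offord bound for zero subset sums in an ordered group. -/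
theorem card_zero_subset_sum_le {ι G : Type*} [DecidableEq ι] [AddCommGroup G] [LinearOrder G]
    [IsOrderedAddMonoid G] (U : Finset ι) (c : ι → G) :
    #{S ∈ U.powerset | ∑ j ∈ S, c j = 0} ≤
      (#{j ∈ U | c j ≠ 0}).choose (#{j ∈ U | c j ≠ 0} / 2) *
        2 ^ (#U - #{j ∈ U | c j ≠ 0}) := by
  set A := {j ∈ U | c j ≠ 0} with hA
  have hAU : A ⊆ U := filter_subset _ _
  rw [← card_sdiff_of_subset hAU, ← card_powerset]
  refine card_le_mul_card_image_of_maps_to (f := fun S => S \ A) ?_ _ ?_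
  · intro S hS
    simp only [mem_filter, mem_powerset] at hS ⊢
    exact sdiff_subset_sdiff hS.1 subset_rfl
  intro T _
  set F : Finset (Finset ι) := {S ∈ {S ∈ U.powerset | ∑ j ∈ S, c j = 0} | S \ A = T} with hF
  let g : Finset ι → Finset A := fun S => {j : A | (j : ι) ∈ S ↔ 0 < c j}
  have key : ∀ S ∈ F, ∀ S' ∈ F, g S ⊆ g S' → S = S' := by
    intro S hS S' hS' hg
    simp only [hF, mem_filter, mem_powerset] at hS hS'
    obtain ⟨⟨hSU, hS0⟩, hST⟩ := hS
    obtain ⟨⟨hSU', hS0'⟩, hST'⟩ := hS'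
    have hg' : ∀ j ∈ A, (j ∈ S ↔ 0 < c j) → (j ∈ S' ↔ 0 < c j) := by
      intro j hj h
      have := @hg ⟨j, hj⟩ (by simpa [g] using h)
      simpa [g] using this
    have hle : ∀ j ∈ U, (if j ∈ S then c j else 0) ≤ (if j ∈ S' then c j else 0) := by
      intro j hj
      by_cases h0 : c j = 0
      · simp [h0]
      have := hg' j (by simp [hA, hj, h0])
      rcases lt_or_gt_of_ne h0 with h | h
      · have h' := h.le
        have h'' := h.not_gt
        split_ifs <;> first | rfl | exact h' | (exfalso; tauto)
      · have h' := h.le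
        split_ifs <;> first | rfl | exact h' | (exfalso; tauto)
    have hsum : ∑ j ∈ U, (if j ∈ S then c j else 0) = ∑ j ∈ U, (if j ∈ S' then c j else 0) := by
      rw [sum_ite_mem, sum_ite_mem, inter_eq_right.2 hSU, inter_eq_right.2 hSU', hS0, hS0']
    have heq := (sum_eq_sum_iff_of_le hle).1 hsum
    ext j
    by_cases hj : j ∈ A
    · have hj' := hj
      simp only [hA, mem_filter] at hj'
      have h1 := heq j hj'.1
      have h2 := hj'.2
      by_cases hs : j ∈ S <;> by_cases hs' : j ∈ S' <;> simp_all
    · have : j ∈ S \ A ↔ j ∈ S' \ A := by rw [hST, hST']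
      simpa [hj] using this
  have hinj : Set.InjOn g F := fun S hS S' hS' h => key S hS S' hS' h.le
  rw [← card_image_of_injOn hinj]
  have hanti : IsAntichain (· ⊆ ·) (SetLike.coe (F.image g)) := by
    intro X hX Y hY hne hsub
    obtain ⟨S, hS, rfl⟩ := mem_image.1 hX
    obtain ⟨S', hS', rfl⟩ := mem_image.1 hY
    exact hne (by rw [key S hS S' hS' hsub])
  simpa using hanti.sperner

theorem card_zero_subset_sum_le_of_linearIndependent {ι K V : Type*} [DecidableEq ι] [Field K]
    [CharZero K] [AddCommGroup V] [DecidableEq V] [Module K V] (U J : Finset ι) (hJ : J ⊆ U)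
    (c : ι → V) (hc : LinearIndependent K (fun j : J => c j)) :
    #{S ∈ U.powerset | ∑ j ∈ S, c j = 0} ≤ 2 ^ (#U - #J) := by
  rw [← card_sdiff_of_subset hJ, ← card_powerset]
  refine card_le_card_of_injOn (fun S => S \ J) ?_ ?_
  · intro S hS
    simp only [coe_filter, mem_powerset, Set.mem_ofPred_eq] at hS
    simp only [coe_powerset, Set.mem_preimage, Set.mem_powerset_iff, coe_subset]
    exact sdiff_subset_sdiff hS.1 subset_rfl
  · intro S hS S' hS' h
    simp only [coe_filter, mem_powerset, Set.mem_ofPred_eq] at hS hS'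
    simp only at h
    have split : ∀ S : Finset ι, ∑ j ∈ S, c j =
        ∑ j ∈ S \ J, c j + ∑ j : J, (if (j : ι) ∈ S then (1 : K) else 0) • c j := by
      intro S
      rw [sum_coe_sort J (fun j => (if j ∈ S then (1 : K) else 0) • c j)]
      simp only [ite_smul, one_smul, zero_smul, sum_ite_mem]
      rw [inter_comm, add_comm, sum_inter_add_sum_sdiff]
    have h1 := hS.2.trans hS'.2.symm
    rw [split S, split S', h, add_right_inj, ← sub_eq_zero, ← sum_sub_distrib] at h1
    simp only [← sub_smul] at h1
    have h2 := Fintype.linearIndependent_iff.1 hc _ h1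
    ext j
    by_cases hj : j ∈ J
    · have h3 : (if j ∈ S then (1 : K) else 0) - (if j ∈ S' then 1 else 0) = 0 := h2 ⟨j, hj⟩
      by_cases hs : j ∈ S <;> by_cases hs' : j ∈ S' <;> simp [hs, hs'] at h3 ⊢
    · have : j ∈ S \ J ↔ j ∈ S' \ J := by rw [h]
      simpa [hj] using this

theorem le_gcd_two_mul_totient_sq (n : ℕ) : n ≤ Nat.gcd 2 n * n.totient ^ 2 := by
  induction n using Nat.recOnPosPrimePosCoprime with
  | prime_pow p k hp hk =>
    obtain ⟨k, rfl⟩ := Nat.exists_eq_succ_of_ne_zero hk.ne'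
    rw [Nat.succ_eq_add_one, Nat.totient_prime_pow_succ hp]
    have h1 : p ≤ Nat.gcd 2 (p ^ (k + 1)) * (p - 1) ^ 2 := by
      obtain rfl | h3 := hp.eq_two_or_odd'
      · rw [pow_succ']; simp
      · have : 0 < Nat.gcd 2 (p ^ (k + 1)) := Nat.gcd_pos_of_pos_left _ two_pos
        have h3 : 3 ≤ p := by
          have := hp.two_le
          rcases h3 with ⟨r, rfl⟩
          omega
        obtain ⟨q, rfl⟩ := Nat.exists_eq_add_of_le h3
        rw [show 3 + q - 1 = q + 2 by omega]
        nlinarith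
    have h2 : p ^ k ≤ (p ^ k) ^ 2 := Nat.le_self_pow two_ne_zero _
    calc p ^ (k + 1) = p ^ k * p := pow_succ _ _
      _ ≤ (p ^ k) ^ 2 * (Nat.gcd 2 (p ^ (k + 1)) * (p - 1) ^ 2) := Nat.mul_le_mul h2 h1
      _ = _ := by ring
  | zero => simp
  | one => simp
  | coprime a b _ _ hab iha ihb =>
    rw [Nat.totient_mul hab, hab.gcd_mul]
    calc a * b ≤ _ := Nat.mul_le_mul iha ihb
      _ = _ := by ring

theorem le_two_mul_totient_sq (n : ℕ) : n ≤ 2 * n.totient ^ 2 :=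
  (le_gcd_two_mul_totient_sq n).trans
    (Nat.mul_le_mul_right _ (Nat.gcd_le_left _ two_pos))

open Polynomial in
/-- A subspace containing all `f x - f y` has at least half the dimension of `ℚ(x)`. -/
theorem natDegree_minpoly_le_two_mul_finrank {K L : Type*} [Field K] [Field L] [Algebra K L]
    {x y : L} (hxy : x ≠ y) (W : Submodule K L) [FiniteDimensional K W]
    (hW : ∀ f : K[X], aeval x f - aeval y f ∈ W) :
    (minpoly K x).natDegree ≤ 2 * Module.finrank K W := by
  set d := (minpoly K x).natDegree with hd
  let ev : K[X] →ₗ[K] W :=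
    ((aeval x).toLinearMap - (aeval y).toLinearMap).codRestrict W (by simpa using hW)
  have hev : ∀ f, (ev f : L) = aeval x f - aeval y f := fun f => rfl
  let e := ev.domRestrict (degreeLT K d)
  have : FiniteDimensional K (degreeLT K d) :=
    LinearEquiv.finiteDimensional (degreeLTEquiv K d).symm
  have hdim : Module.finrank K (degreeLT K d) = d := by
    rw [LinearEquiv.finrank_eq (degreeLTEquiv K d)]; simp
  have hrn := LinearMap.finrank_range_add_finrank_ker e
  have hrange := Submodule.finrank_le (LinearMap.range e)
  let m : LinearMap.ker e →ₗ[K] W :=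
    ev ∘ₗ LinearMap.mulLeft K (X : K[X]) ∘ₗ (degreeLT K d).subtype ∘ₗ (LinearMap.ker e).subtype
  have hm : Function.Injective m := by
    rw [injective_iff_map_eq_zero]
    rintro ⟨⟨f, hf⟩, hfe⟩ h
    have h1 : aeval x f - aeval y f = 0 := congrArg Subtype.val (LinearMap.mem_ker.1 hfe)
    have h2 : aeval x (X * f) - aeval y (X * f) = 0 := congrArg Subtype.val h
    rw [map_mul, map_mul, aeval_X, aeval_X, ← sub_eq_zero.1 h1, ← sub_mul] at h2
    have h3 : aeval x f = 0 := (mul_eq_zero.1 h2).resolve_left (sub_ne_zero.2 hxy)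
    have h4 : f = 0 := by
      by_contra hf0
      have h5 := natDegree_le_natDegree (minpoly.degree_le_of_ne_zero K x hf0 h3)
      exact absurd ((natDegree_lt_iff_degree_lt hf0).2 (mem_degreeLT.1 hf)) (by omega)
    simp [h4]
  have hker := LinearMap.finrank_le_finrank_of_injective hm
  omega

variable {n : ℕ}

/-- The coefficient of the indicator of `j` in `λ_a - λ_b`. -/
noncomputable def eigCoeff (a b j : ZMod n) : ℂ := zetaC n ^ (a * j).val - zetaC n ^ (b * j).val

theorem cayEig_eq_iff (S : Finset (ZMod n)) (a b : ZMod n) :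
    cayEig n S a = cayEig n S b ↔ ∑ j ∈ S, eigCoeff a b j = 0 := by
  simp only [cayEig, eigCoeff, sum_sub_distrib, sub_eq_zero]

variable [NeZero n]

theorem isPrimitiveRoot_zetaC : IsPrimitiveRoot (zetaC n) n := by
  have h := (Complex.isPrimitiveRoot_exp n (NeZero.ne n)).inv
  rwa [← Complex.exp_neg, ← neg_div] at h

theorem zetaC_pow_mul_val (a j : ZMod n) :
    zetaC n ^ (a * j).val = (zetaC n ^ a.val) ^ j.val := by
  have h := pow_mod_orderOf (zetaC n) (a.val * j.val)
  rwa [← isPrimitiveRoot_zetaC.eq_orderOf, ← ZMod.val_mul, pow_mul] at h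

theorem zetaC_pow_val_injective : Function.Injective fun a : ZMod n => zetaC n ^ a.val :=
  fun a b h => ZMod.val_injective n <|
    isPrimitiveRoot_zetaC.pow_inj (ZMod.val_lt a) (ZMod.val_lt b) h

theorem eigCoeff_eq_zero_iff (a b j : ZMod n) : eigCoeff a b j = 0 ↔ a * j = b * j := by
  rw [eigCoeff, sub_eq_zero]
  exact zetaC_pow_val_injective.eq_iff

theorem ne_zero_of_eigCoeff_ne_zero {a b j : ZMod n} (h : eigCoeff a b j ≠ 0) : j ≠ 0 := by
  rintro rfl
  exact h (by simp [eigCoeff_eq_zero_iff])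

/-- The sets `S ⊆ Z_n \ {0}` with `λ_a = λ_b`. -/
noncomputable def collisionSets (a b : ZMod n) : Finset (Finset (ZMod n)) :=
  {S ∈ (univ.erase (0 : ZMod n)).powerset | ∑ j ∈ S, eigCoeff a b j = 0}

theorem card_univ_erase_zero : #(univ.erase (0 : ZMod n)) = n - 1 := by
  rw [card_erase_of_mem (mem_univ _), card_univ, ZMod.card]

theorem le_two_mul_card_eigCoeff_ne_zero {a b : ZMod n} (hab : a ≠ b) :
    n ≤ 2 * #{j ∈ univ.erase (0 : ZMod n) | eigCoeff a b j ≠ 0} := by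
  have h1 : #{j : ZMod n | eigCoeff a b j = 0} ≤
      #{j ∈ univ.erase (0 : ZMod n) | eigCoeff a b j ≠ 0} := by
    refine card_le_card_of_injOn (· + 1) ?_ (add_left_injective 1).injOn
    intro j hj
    have hj' : a * j = b * j := by simpa [eigCoeff_eq_zero_iff] using hj
    have h : eigCoeff a b (j + 1) ≠ 0 := by
      rw [Ne, eigCoeff_eq_zero_iff, mul_add, mul_add, hj', add_right_inj, mul_one, mul_one]
      exact hab
    simpa [h] using ne_zero_of_eigCoeff_ne_zero h
  have h2 : #{j : ZMod n | eigCoeff a b j ≠ 0} =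
      #{j ∈ univ.erase (0 : ZMod n) | eigCoeff a b j ≠ 0} := by
    congr 1
    ext j
    simpa using ne_zero_of_eigCoeff_ne_zero
  have h3 := card_filter_add_card_filter_not (s := (univ : Finset (ZMod n)))
    (fun j => eigCoeff a b j = 0)
  rw [card_univ, ZMod.card] at h3
  simp only [ne_eq] at *
  omega

theorem card_collisionSets_le_of_ne {a b : ZMod n} (hab : a ≠ b) :
    (#(collisionSets a b) : ℝ) ≤ 2 * (n : ℝ) ^ (-(1 / 2 : ℝ)) * 2 ^ (n - 1) := by
  let φ : ℂ →+ ℝ ×ₗ ℝ :=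
    { toFun := fun z => toLex (z.re, z.im)
      map_zero' := rfl
      map_add' := fun _ _ => rfl }
  have hφ : ∀ z, φ z = 0 ↔ z = 0 := fun z => by
    change toLex (z.re, z.im) = toLex (0, 0) ↔ _
    rw [toLex_inj, Prod.mk.injEq, Complex.ext_iff]
    rfl
  have h := card_zero_subset_sum_le (univ.erase (0 : ZMod n)) (fun j => φ (eigCoeff a b j))
  simp only [← map_sum, ne_eq, hφ] at h
  have hn := le_two_mul_card_eigCoeff_ne_zero hab
  simp only [ne_eq] at hn
  have hm : #{j ∈ univ.erase (0 : ZMod n) | ¬ eigCoeff a b j = 0} ≤ n - 1 :=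
    (card_filter_le _ _).trans card_univ_erase_zero.le
  rw [card_univ_erase_zero] at h
  change #(collisionSets a b) ≤ _ at h
  generalize #{j ∈ univ.erase (0 : ZMod n) | ¬ eigCoeff a b j = 0} = m at *
  have h0 : 0 < n := NeZero.pos n
  have hc : ((m.choose (m / 2) : ℕ) : ℝ) ≤ 2 * (n : ℝ) ^ (-(1 / 2 : ℝ)) * 2 ^ m := by
    refine abs_le_of_sq_le_sq' ?_ (by positivity) |>.2
    have h1 : ((m.choose (m / 2) : ℕ) : ℝ) ^ 2 * (m + 1) ≤ 4 ^ m := by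
      exact_mod_cast choose_half_sq_mul_le m
    have h2 : (n : ℝ) ≤ 2 * m := by exact_mod_cast hn
    have hn0 : (0 : ℝ) < n := by exact_mod_cast h0
    have h3 : ((n : ℝ) ^ (-(1 / 2 : ℝ))) ^ 2 = (n : ℝ)⁻¹ := by
      rw [← Real.rpow_natCast, ← Real.rpow_mul hn0.le]
      norm_num [Real.rpow_neg_one]
    rw [mul_pow, mul_pow, h3, ← pow_mul, mul_comm m 2, pow_mul]
    norm_num
    rw [mul_right_comm, ← div_eq_mul_inv, le_div_iff₀ hn0]
    nlinarith [sq_nonneg ((m.choose (m / 2) : ℕ) : ℝ)]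
  calc (#(collisionSets a b) : ℝ) ≤ (m.choose (m / 2) : ℕ) * 2 ^ (n - 1 - m) := by
        exact_mod_cast h
    _ ≤ 2 * (n : ℝ) ^ (-(1 / 2 : ℝ)) * 2 ^ m * 2 ^ (n - 1 - m) := by gcongr
    _ = 2 * (n : ℝ) ^ (-(1 / 2 : ℝ)) * 2 ^ (n - 1) := by
      rw [mul_assoc _ (2 ^ m), ← pow_add, Nat.add_sub_cancel' hm]

theorem collisionSets_comm (a b : ZMod n) : collisionSets a b = collisionSets b a := by
  refine filter_congr fun S _ => ?_
  rw [← cayEig_eq_iff, ← cayEig_eq_iff, eq_comm]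

theorem orderOf_zetaC_pow_pos (a : ZMod n) : 0 < orderOf (zetaC n ^ a.val) := by
  refine orderOf_pos_iff.2 (IsOfFinOrder.pow ?_)
  exact isOfFinOrder_iff_pow_eq_one.2 ⟨n, NeZero.pos n, isPrimitiveRoot_zetaC.pow_eq_one⟩

/-- If `ζ_n ^ a` has large order, then few sets `S` satisfy `λ_a = λ_b`. -/
theorem exists_card_collisionSets_le {a b : ZMod n} (hab : a ≠ b) :
    ∃ r : ℕ, orderOf (zetaC n ^ a.val) ≤ 8 * r ^ 2 ∧ #(collisionSets a b) * 2 ^ r ≤ 2 ^ (n - 1) := by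
  classical
  obtain ⟨κ, f, hf, hspan, hli⟩ := exists_linearIndependent' ℚ (eigCoeff a b)
  have : Finite κ := Finite.of_injective f hf
  have : Fintype κ := Fintype.ofFinite κ
  refine ⟨Fintype.card κ, ?_, ?_⟩
  · have hrank := finrank_span_eq_card hli
    rw [hspan] at hrank
    have hpow : ∀ i : ℕ, (zetaC n ^ a.val) ^ i - (zetaC n ^ b.val) ^ i ∈
        Submodule.span ℚ (Set.range (eigCoeff a b)) := by
      intro i
      have h : eigCoeff a b (i : ZMod n) =
          (zetaC n ^ a.val) ^ i - (zetaC n ^ b.val) ^ i := by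
        have hx : ∀ a : ZMod n, (zetaC n ^ a.val) ^ (i % n) = (zetaC n ^ a.val) ^ i := by
          intro a
          conv_rhs => rw [← Nat.div_add_mod i n]
          rw [pow_add, pow_mul, ← pow_mul _ _ n, mul_comm a.val n, pow_mul _ n,
            isPrimitiveRoot_zetaC.pow_eq_one, one_pow, one_pow, one_mul]
        rw [eigCoeff, zetaC_pow_mul_val, zetaC_pow_mul_val, ZMod.val_natCast, hx, hx]
      exact h ▸ Submodule.subset_span ⟨_, rfl⟩
    have : FiniteDimensional ℚ (Submodule.span ℚ (Set.range (eigCoeff a b))) :=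
      FiniteDimensional.span_of_finite ℚ (Set.finite_range _)
    have h1 := natDegree_minpoly_le_two_mul_finrank (K := ℚ)
      (zetaC_pow_val_injective.ne hab) (Submodule.span ℚ (Set.range (eigCoeff a b))) (by
        intro p
        rw [Polynomial.aeval_eq_sum_range, Polynomial.aeval_eq_sum_range, ← sum_sub_distrib]
        refine Submodule.sum_mem _ fun i _ => ?_
        rw [← smul_sub]
        exact Submodule.smul_mem _ _ (hpow i))
    rw [hrank, ← Polynomial.cyclotomic_eq_minpoly_rat (IsPrimitiveRoot.orderOf _)
      (orderOf_zetaC_pow_pos a), Polynomial.natDegree_cyclotomic] at h1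
    calc _ ≤ 2 * (orderOf (zetaC n ^ a.val)).totient ^ 2 := le_two_mul_totient_sq _
      _ ≤ 2 * (2 * Fintype.card κ) ^ 2 := by gcongr
      _ = 8 * Fintype.card κ ^ 2 := by ring
  · let J : Finset (ZMod n) := univ.map ⟨f, hf⟩
    have hJ : J ⊆ univ.erase (0 : ZMod n) := by
      intro j hj
      obtain ⟨k, _, rfl⟩ := mem_map.1 hj
      simpa using ne_zero_of_eigCoeff_ne_zero (hli.ne_zero k)
    have hJc : #J = Fintype.card κ := by simp [J]
    have hJli : LinearIndependent ℚ (fun j : J => eigCoeff a b j) := by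
      have h2 : LinearIndepOn ℚ (eigCoeff a b) (Set.range f) :=
        (linearIndepOn_range_iff hf _).2 hli
      have h3 : (J : Set (ZMod n)) = Set.range f := by simp [J]
      rw [← h3] at h2
      exact h2
    have h := card_zero_subset_sum_le_of_linearIndependent _ J hJ _ hJli
    have hle := card_le_card hJ
    rw [card_univ_erase_zero, hJc] at *
    calc _ ≤ 2 ^ (n - 1 - Fintype.card κ) * 2 ^ Fintype.card κ := Nat.mul_le_mul_right _ h
      _ = _ := by rw [← pow_add, Nat.sub_add_cancel hle]

theorem card_orderOf_zetaC_pow_le (M : ℕ) :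
    #{a : ZMod n | orderOf (zetaC n ^ a.val) ≤ M} ≤ M ^ 2 := by
  classical
  calc #{a : ZMod n | orderOf (zetaC n ^ a.val) ≤ M}
      ≤ #((Icc 1 M).biUnion fun k => Polynomial.nthRootsFinset k (1 : ℂ)) := by
        refine card_le_card_of_injOn _ ?_ zetaC_pow_val_injective.injOn
        intro a ha
        have hpos := orderOf_zetaC_pow_pos a
        simp only [coe_filter, mem_univ, true_and, Set.mem_ofPred_eq] at ha
        simp only [mem_coe, mem_biUnion, mem_Icc]
        exact ⟨_, ⟨hpos, ha⟩, (Polynomial.mem_nthRootsFinset hpos _).2 (pow_orderOf_eq_one _)⟩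
    _ ≤ #(Icc 1 M) * M := by
        refine card_biUnion_le_card_mul _ _ _ fun k hk => ?_
        refine le_trans ?_ (mem_Icc.1 hk).2
        rw [Polynomial.nthRootsFinset]
        exact (Multiset.toFinset_card_le _).trans (Polynomial.card_nthRoots k 1)
    _ = M ^ 2 := by rw [Nat.card_Icc, Nat.add_sub_cancel, sq]

theorem card_collisionSets_le_exp {T : ℝ} {a b : ZMod n} (hab : a ≠ b)
    (hT : T < orderOf (zetaC n ^ a.val)) :
    (#(collisionSets a b) : ℝ) ≤ Real.exp (-(Real.log 2 / 3) * √T) * 2 ^ (n - 1) := by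
  obtain ⟨r, hr, h⟩ := exists_card_collisionSets_le hab
  have hr' : T ≤ (3 * r) ^ 2 := by
    have : (orderOf (zetaC n ^ a.val) : ℝ) ≤ 8 * r ^ 2 := by exact_mod_cast hr
    nlinarith [sq_nonneg (r : ℝ)]
  have hsqrt : √T ≤ 3 * r := Real.sqrt_le_iff.2 ⟨by positivity, hr'⟩
  have hlog : 0 < Real.log 2 := Real.log_pos one_lt_two
  have hexp : ((2 : ℝ) ^ r)⁻¹ ≤ Real.exp (-(Real.log 2 / 3) * √T) := by
    rw [← Real.exp_log (two_pos : (0 : ℝ) < 2), ← Real.exp_nat_mul, ← Real.exp_neg,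
      Real.exp_le_exp, Real.log_exp]
    nlinarith
  have h' : (#(collisionSets a b) : ℝ) * 2 ^ r ≤ 2 ^ (n - 1) := by exact_mod_cast h
  calc (#(collisionSets a b) : ℝ) ≤ (2 ^ r : ℝ)⁻¹ * 2 ^ (n - 1) := by
        rw [inv_mul_eq_div]
        exact (le_div_iff₀ (by positivity)).2 h'
    _ ≤ _ := by gcongr

theorem ncard_not_injective_cayEig_le (T : ℝ) (hT : 0 ≤ T) :
    ({S : Finset (ZMod n) | (0 : ZMod n) ∉ S ∧ ¬ Function.Injective (cayEig n S)}.ncard : ℝ) ≤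
      (2 * T ^ 4 * (n : ℝ) ^ (-(1 / 2 : ℝ)) +
        (n : ℝ) ^ 2 * Real.exp (-(Real.log 2 / 3) * √T)) * 2 ^ (n - 1) := by
  classical
  set small : Finset (ZMod n) := {a | orderOf (zetaC n ^ a.val) ≤ ⌊T⌋₊} with hsmall
  set P : Finset (ZMod n × ZMod n) := {p | p.1 ≠ p.2} with hP
  have hsub : {S : Finset (ZMod n) | (0 : ZMod n) ∉ S ∧ ¬ Function.Injective (cayEig n S)} ⊆
      (P.biUnion fun p => collisionSets p.1 p.2 : Finset (Finset (ZMod n))) := by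
    rintro S ⟨h0, hS⟩
    simp only [Function.Injective, not_forall] at hS
    obtain ⟨a, b, h, hab⟩ := hS
    refine mem_coe.2 (mem_biUnion.2 ⟨(a, b), by simpa [hP] using hab, ?_⟩)
    refine mem_filter.2 ⟨mem_powerset.2 fun j hj => ?_, (cayEig_eq_iff S a b).1 h⟩
    exact mem_erase.2 ⟨fun h => h0 (h ▸ hj), mem_univ _⟩
  have hcard : (#small : ℝ) ≤ T ^ 2 := by
    calc (#small : ℝ) ≤ (⌊T⌋₊ : ℝ) ^ 2 := by exact_mod_cast card_orderOf_zetaC_pow_le _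
      _ ≤ T ^ 2 := by
        gcongr
        exact Nat.floor_le hT
  have hbig : ∀ a, a ∉ small → T < orderOf (zetaC n ^ a.val) := by
    intro a ha
    exact Nat.lt_of_floor_lt (by simpa [hsmall] using ha)
  have hterm : ∀ p ∈ P, (#(collisionSets p.1 p.2) : ℝ) ≤
      (if p ∈ small ×ˢ small then 2 * (n : ℝ) ^ (-(1 / 2 : ℝ)) * 2 ^ (n - 1) else 0) +
        Real.exp (-(Real.log 2 / 3) * √T) * 2 ^ (n - 1) := by
    rintro ⟨a, b⟩ hp
    have hab : a ≠ b := by simpa [hP] using hp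
    split_ifs with h
    · exact (card_collisionSets_le_of_ne hab).trans (le_add_of_nonneg_right (by positivity))
    · rw [zero_add]
      by_cases ha : a ∈ small
      · have hb : b ∉ small := fun hb => h (mk_mem_product ha hb)
        rw [collisionSets_comm]
        exact card_collisionSets_le_exp hab.symm (hbig b hb)
      · exact card_collisionSets_le_exp hab (hbig a ha)
  calc _ ≤ ((#(P.biUnion fun p => collisionSets p.1 p.2) : ℕ) : ℝ) := by
        rw [← Set.ncard_coe_finset]
        exact_mod_cast Set.ncard_le_ncard hsub (finite_toSet _)
    _ ≤ ∑ p ∈ P, (#(collisionSets p.1 p.2) : ℝ) := by exact_mod_cast card_biUnion_le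
    _ ≤ _ := sum_le_sum hterm
    _ ≤ ∑ p : ZMod n × ZMod n,
        ((if p ∈ small ×ˢ small then 2 * (n : ℝ) ^ (-(1 / 2 : ℝ)) * 2 ^ (n - 1) else 0) +
          Real.exp (-(Real.log 2 / 3) * √T) * 2 ^ (n - 1)) := by
        refine sum_le_sum_of_subset_of_nonneg (subset_univ _) fun p _ _ => ?_
        split_ifs <;> positivity
    _ = (#small : ℝ) ^ 2 * (2 * (n : ℝ) ^ (-(1 / 2 : ℝ)) * 2 ^ (n - 1)) +
        (n : ℝ) ^ 2 * (Real.exp (-(Real.log 2 / 3) * √T) * 2 ^ (n - 1)) := by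
        rw [sum_add_distrib, sum_ite_mem, univ_inter, sum_const, sum_const, card_product,
          card_univ, Fintype.card_prod, ZMod.card]
        simp only [nsmul_eq_mul, Nat.cast_mul, sq]
    _ ≤ (T ^ 2) ^ 2 * (2 * (n : ℝ) ^ (-(1 / 2 : ℝ)) * 2 ^ (n - 1)) +
        (n : ℝ) ^ 2 * (Real.exp (-(Real.log 2 / 3) * √T) * 2 ^ (n - 1)) := by gcongr
    _ = _ := by ring

open Filter in
theorem eventually_collision_bound_le {ε c : ℝ} (hε : 0 < ε) (hc : 0 < c) :
    ∀ᶠ x : ℝ in atTop, 2 * (x ^ (ε / 8)) ^ 4 * x ^ (-(1 / 2 : ℝ)) +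
      x ^ 2 * Real.exp (-c * √(x ^ (ε / 8))) ≤ x ^ (-(1 / 2 : ℝ) + ε) := by
  have h1 : ∀ᶠ x : ℝ in atTop, 3 ≤ x ^ (ε / 2) :=
    (tendsto_rpow_atTop (by positivity)).eventually_ge_atTop 3
  have h2 := ((tendsto_rpow_mul_exp_neg_mul_atTop_nhds_zero (48 / ε) c hc).comp
    (tendsto_rpow_atTop (show 0 < ε / 16 by positivity))).eventually_le_const one_pos
  filter_upwards [h1, h2, eventually_ge_atTop 1] with x h1 h2 hx
  have hx0 : 0 < x := by linarith
  have e1 : (x ^ (ε / 8)) ^ 4 = x ^ (ε / 2) := by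
    rw [← Real.rpow_natCast, ← Real.rpow_mul hx0.le]
    congr 1
    push_cast
    ring
  have e2 : √(x ^ (ε / 8)) = x ^ (ε / 16) := by
    rw [Real.sqrt_eq_rpow, ← Real.rpow_mul hx0.le]
    congr 1
    ring
  have e3 : (x ^ (ε / 16)) ^ (48 / ε) = x ^ 3 := by
    rw [← Real.rpow_mul hx0.le, ← Real.rpow_natCast]
    congr 1
    field_simp
    norm_num
  simp only [Function.comp_apply, e3] at h2
  have h3 : x ^ 2 * Real.exp (-c * x ^ (ε / 16)) ≤ x ^ (-(1 / 2 : ℝ)) := by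
    calc x ^ 2 * Real.exp (-c * x ^ (ε / 16)) ≤ x ^ (-1 : ℝ) := by
          rw [Real.rpow_neg_one, ← one_div, le_div_iff₀ hx0]
          calc _ = _ := by ring
            _ ≤ 1 := h2
      _ ≤ _ := Real.rpow_le_rpow_of_exponent_le hx (by norm_num)
  rw [e1, e2, Real.rpow_add hx0, show x ^ ε = x ^ (ε / 2) * x ^ (ε / 2) by
    rw [← Real.rpow_add hx0, add_halves]]
  have hy : 0 < x ^ (-(1 / 2 : ℝ)) := by positivity
  nlinarith [mul_le_mul_of_nonneg_left h1 hy.le, mul_nonneg hy.le (sq_nonneg (x ^ (ε / 2) - 3)),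
    mul_nonneg hy.le (sub_nonneg.2 h1)]

end

/-- For every `ε > 0` and all sufficiently large `n`, the number of connection sets
`S ⊆ Z_n \ {0}` for which the values `λ_{a,S}` (`a ∈ Z_n`) are not pairwise distinct
is at most `n^{-1/2+ε} · 2^{n-1}`; i.e., a uniformly random Cayley digraph
`Cay(Z_n,S)` has simple spectrum with probability at least `1 - n^{-1/2+ε}`. -/
theorem stmt5 :
    ∀ ε : ℝ, 0 < ε → ∃ N : ℕ, ∀ n : ℕ, N ≤ n →
      ({S : Finset (ZMod n) | (0 : ZMod n) ∉ S ∧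
          ¬ Function.Injective (cayEig n S)}.ncard : ℝ) ≤
        (n : ℝ) ^ (-(1 / 2 : ℝ) + ε) * 2 ^ (n - 1) := by
  intro ε hε
  obtain ⟨N, hN⟩ := Filter.eventually_atTop.1 (tendsto_natCast_atTop_atTop.eventually
    (eventually_collision_bound_le hε (div_pos (Real.log_pos one_lt_two) three_pos)))
  refine ⟨N + 1, fun n hn => ?_⟩
  have : NeZero n := ⟨by omega⟩
  refine (ncard_not_injective_cayEig_le _ (Real.rpow_nonneg n.cast_nonneg (ε / 8))).trans ?_
  exact mul_le_mul_of_nonneg_right (hN n (by omega)) (by positivity)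
end

section
/- For every positive integer n, the number of inverse-closed subsets S ⊆ Z_n \ {0} (i.e., with S = −S) for which there exists a unit a of Z_n with a ∉ {1, −1} and aS = S is less than 2n·2^{−n/8}·2^{⌊n/2⌋}. Equivalently, a uniformly random inverse-closed connection set is not multiplier-free with probability less than 2n·2^{−n/8}. -/
open Finset in
theorem card_family_le {α : Type*} [Fintype α] [DecidableEq α] (F : Finset (Finset α)) (w : α → ℕ) (c : ℕ)
    (hw : ∀ S ∈ F, ∀ x ∈ S, ∃ T : Finset α, c ≤ ∑ y ∈ T, w y ∧ ∀ y ∈ T, ∀ S ∈ F, x ∈ S ↔ y ∈ S) :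
    ∃ k, F.card ≤ 2 ^ k ∧ c * k ≤ ∑ x, w x := by
  classical
  let f : α → Finset (Finset α) := fun x => F.filter (x ∈ ·)
  have hf : ∀ x y, f x = f y ↔ ∀ S ∈ F, x ∈ S ↔ y ∈ S := fun x y => by
    simp [f, Finset.ext_iff]
  let K := (univ.image f).filter (·.Nonempty)
  refine ⟨K.card, ?_, ?_⟩
  · rw [← card_powerset]
    refine card_le_card_of_injOn (fun S => S.image f) ?_ ?_
    · intro S hS
      simp only [coe_powerset, Set.mem_preimage, Set.mem_powerset_iff, coe_subset]
      intro y hy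
      obtain ⟨x, hx, rfl⟩ := mem_image.1 hy
      simp only [K, mem_filter, mem_image, mem_univ, true_and, exists_apply_eq_apply]
      exact ⟨S, by simpa [f] using ⟨hS, hx⟩⟩
    · have key : ∀ S ∈ F, ∀ x, f x ∈ S.image f ↔ x ∈ S := by
        intro S hS x
        refine ⟨fun h => ?_, fun h => mem_image_of_mem f h⟩
        obtain ⟨y, hy, hyx⟩ := mem_image.1 h
        exact ((hf y x).1 hyx S hS).1 hy
      intro S hS S' hS' h
      ext x
      rw [← key S hS, ← key S' hS']
      exact iff_of_eq (congrArg (f x ∈ ·) h)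
  · calc c * K.card = ∑ _b ∈ K, c := by rw [sum_const, smul_eq_mul, mul_comm]
      _ ≤ ∑ b ∈ K, ∑ x with f x = b, w x := by
        refine sum_le_sum fun b hb => ?_
        obtain ⟨hb, S, hS⟩ := mem_filter.1 hb
        obtain ⟨x, -, rfl⟩ := mem_image.1 hb
        obtain ⟨hS, hx⟩ := mem_filter.1 hS
        obtain ⟨T, hT, hxT⟩ := hw S hS x hx
        refine hT.trans (sum_le_sum_of_subset fun y hy => ?_)
        simpa using ((hf x y).2 (hxT y hy)).symm
      _ ≤ ∑ b ∈ univ.image f, ∑ x with f x = b, w x :=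
        sum_le_sum_of_subset (filter_subset _ _)
      _ = ∑ x, w x := sum_fiberwise_of_maps_to (fun x _ => mem_image_of_mem f (mem_univ x)) w

theorem card_mul_card_le_card_inf_mul {G : Type*} [AddCommGroup G] [Finite G] (A B : AddSubgroup G) :
    Nat.card A * Nat.card B ≤ Nat.card (A ⊓ B : AddSubgroup G) * Nat.card G := by
  have h1 : A.relIndex B ∣ A.index := AddSubgroup.relIndex_dvd_index_of_normal A B
  have h2 := A.card_mul_index
  have h3 := Nat.le_of_dvd (Nat.pos_of_ne_zero A.index_ne_zero_of_finite) h1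
  have h4 : Nat.card (A ⊓ B : AddSubgroup G) * A.relIndex B = Nat.card B := by
    rw [← AddSubgroup.relIndex_bot_left, ← AddSubgroup.relIndex_bot_left B,
      ← AddSubgroup.inf_relIndex_right A B]
    exact AddSubgroup.relIndex_mul_relIndex _ _ _ bot_le inf_le_right
  rw [← h4, ← h2]
  nlinarith [Nat.mul_le_mul_left (Nat.card A * Nat.card (A ⊓ B : AddSubgroup G)) h3]

theorem two_mul_card_le_of_ne_top {G : Type*} [AddCommGroup G] [Finite G] (A : AddSubgroup G)
    (hA : A ≠ ⊤) : 2 * Nat.card A ≤ Nat.card G := by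
  rw [← A.card_mul_index, mul_comm]
  exact Nat.mul_le_mul_left _ (A.one_lt_index_of_ne_top hA)

theorem ZMod.eq_zero_or_eq_half_of_add_self {n : ℕ} [NeZero n] (x : ZMod n) (h : x + x = 0) : x = 0 ∨ x = (n / 2 : ℕ) ∧ Even n := by
  have h1 : -x = x := neg_eq_of_add_eq_zero_left h
  rcases (ZMod.neg_eq_self_iff x).1 h1 with h | h
  · exact .inl h
  · refine .inr ⟨?_, ⟨x.val, by omega⟩⟩
    rw [← ZMod.natCast_zmod_val x]; congr 1; omega

open Finset in
theorem ZMod.card_add_self_eq_zero_le (n : ℕ) [NeZero n] :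
    #{x : ZMod n | x + x = 0} + n % 2 ≤ 2 := by
  rcases Nat.even_or_odd n with h | h
  · have : ({x : ZMod n | x + x = 0} : Finset (ZMod n)) ⊆ {0, ((n / 2 : ℕ) : ZMod n)} := by
      intro x hx
      rcases ZMod.eq_zero_or_eq_half_of_add_self x (by simpa using hx) with h | h <;> simp [h]
    have := (card_le_card this).trans card_le_two
    have := Nat.even_iff.1 h
    omega
  · have : ({x : ZMod n | x + x = 0} : Finset (ZMod n)) ⊆ {0} := by
      intro x hx
      rcases ZMod.eq_zero_or_eq_half_of_add_self x (by simpa using hx) with h' | h'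
      · simp [h']
      · exact absurd h'.2 (Nat.not_even_iff_odd.2 h)
    have := card_le_card this
    have := Nat.odd_iff.1 h
    simp only [card_singleton] at *
    omega

theorem two_mul_add_le_of_mul_le {p q n : ℕ} (hp : 2 * p ≤ n) (hq : 2 * q ≤ n) (h : p * q ≤ 2 * n) :
    2 * (p + q) ≤ n + 8 := by
  rcases lt_or_ge p 4 with h4 | h4
  · omega
  · nlinarith [Nat.mul_le_mul_left (p - 4) hp, Nat.sub_add_cancel h4]

open Finset in
theorem ZMod.two_mul_card_mul_eq_self_or_neg_le {n : ℕ} [NeZero n] {a : ZMod n} (h1 : a ≠ 1)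
    (h2 : a ≠ -1) : 2 * #{x : ZMod n | a * x = x ∨ a * x = -x} ≤ n + 6 := by
  let A := (AddMonoidHom.mulLeft a - AddMonoidHom.id _).ker
  let B := (AddMonoidHom.mulLeft a + AddMonoidHom.id _).ker
  have mA : ∀ x, x ∈ A ↔ a * x = x := fun x => by simp [A, AddMonoidHom.mem_ker, sub_eq_zero]
  have mB : ∀ x, x ∈ B ↔ a * x = -x := fun x => by
    simp [B, AddMonoidHom.mem_ker, add_eq_zero_iff_eq_neg]
  have cA : Nat.card A = #{x : ZMod n | a * x = x} := by
    rw [Nat.subtype_card]; simp [mA]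
  have cB : Nat.card B = #{x : ZMod n | a * x = -x} := by
    rw [Nat.subtype_card]; simp [mB]
  have hA := two_mul_card_le_of_ne_top A fun h => h1 <| by
    simpa using (mA 1).1 (h ▸ AddSubgroup.mem_top _)
  have hB := two_mul_card_le_of_ne_top B fun h => h2 <| by
    simpa using (mB 1).1 (h ▸ AddSubgroup.mem_top _)
  have hAB := card_mul_card_le_card_inf_mul A B
  have hinf : Nat.card (A ⊓ B : AddSubgroup (ZMod n)) ≤ 2 := by
    have : Nat.card (A ⊓ B : AddSubgroup (ZMod n)) ≤ #{x : ZMod n | x + x = 0} := by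
      rw [Nat.subtype_card {x : ZMod n | a * x = x ∧ a * x = -x} (by simp [mA, mB])]
      refine card_le_card fun x hx => ?_
      simp only [mem_filter, mem_univ, true_and] at hx ⊢
      exact eq_neg_iff_add_eq_zero.1 (hx.1.symm.trans hx.2)
    have := ZMod.card_add_self_eq_zero_le n
    omega
  rw [Nat.card_zmod] at hA hB hAB
  have := two_mul_add_le_of_mul_le hA hB (hAB.trans (Nat.mul_le_mul_right n hinf))
  rw [cA, cB, ← card_union_add_card_inter, ← filter_or] at this
  have : 0 < #(({x : ZMod n | a * x = x} : Finset (ZMod n)) ∩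
      ({x : ZMod n | a * x = -x} : Finset (ZMod n))) := card_pos.2 ⟨0, by simp⟩
  omega

open Finset in
/-- The sets counted on the left are unions of orbits of `⟨a, -1⟩` on the nonzero residues. -/
theorem ZMod.exists_card_invariant_le {n : ℕ} [NeZero n] {a : ZMod n} (ha : IsUnit a) (h1 : a ≠ 1)
    (h2 : a ≠ -1) : ∃ k, #{S : Finset (ZMod n) | 0 ∉ S ∧ (∀ x : ZMod n, x ∈ S ↔ -x ∈ S) ∧
      S.image (fun s => a * s) = S} ≤ 2 ^ k ∧ 8 * k + n < 8 + 8 * (n / 2) := by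
  let w : ZMod n → ℕ := fun x =>
    if x = 0 then 0 else if x + x = 0 then 4 else if a * x = x ∨ a * x = -x then 2 else 1
  have w_pos : ∀ x, x ≠ 0 → 1 ≤ w x := fun x hx => by
    simp only [w, if_neg hx]; split_ifs <;> norm_num
  have w_neg : ∀ x, w (-x) = w x := fun x => by
    have : -x + -x = 0 ↔ x + x = 0 := by rw [← neg_add, neg_eq_zero]
    simp only [w, neg_eq_zero, mul_neg, neg_inj, this]
  obtain ⟨k, hk, hkw⟩ := card_family_le {S : Finset (ZMod n) | 0 ∉ S ∧
      (∀ x : ZMod n, x ∈ S ↔ -x ∈ S) ∧ S.image (fun s => a * s) = S} w 4 (by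
    intro S hS x hx
    have h0 : ∀ S ∈ ({S : Finset (ZMod n) | 0 ∉ S ∧ (∀ x : ZMod n, x ∈ S ↔ -x ∈ S) ∧
        S.image (fun s => a * s) = S} : Finset (Finset (ZMod n))), 0 ∉ S ∧
        (∀ x : ZMod n, x ∈ S ↔ -x ∈ S) ∧ ∀ x, x ∈ S ↔ a * x ∈ S := by
      intro S hS
      simp only [mem_filter, mem_univ, true_and] at hS
      refine ⟨hS.1, hS.2.1, fun x => ?_⟩
      conv_rhs => rw [← hS.2.2]
      rw [mem_image]
      exact ⟨fun h => ⟨x, h, rfl⟩, fun ⟨y, hy, h⟩ => ha.mul_left_cancel h ▸ hy⟩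
    have hx0 : x ≠ 0 := fun h => (h0 S hS).1 (h ▸ hx)
    by_cases hxx : x + x = 0
    · exact ⟨{x}, by simp [w, hx0, hxx], by simp⟩
    have hne : x ≠ -x := fun h => hxx (eq_neg_iff_add_eq_zero.1 h)
    by_cases hax : a * x = x ∨ a * x = -x
    · refine ⟨{x, -x}, ?_, ?_⟩
      · rw [sum_pair hne, w_neg]
        simp [w, hx0, hxx, hax]
      · intro y hy S hS
        rcases mem_insert.1 hy with rfl | hy
        · rfl
        · rw [mem_singleton.1 hy]; exact (h0 S hS).2.1 x
    · push Not at hax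
      have hax0 : a * x ≠ 0 := fun h => hx0 (ha.mul_right_eq_zero.1 h)
      have hne' : a * x ≠ -(a * x) := fun h => hne (ha.mul_left_cancel (by rwa [mul_neg]))
      have hT : #{x, -x, a * x, -(a * x)} = 4 := by
        rw [card_insert_of_notMem, card_insert_of_notMem, card_pair hne']
        · simp [neg_eq_iff_eq_neg, hax.1.symm, hax.2.symm]
        · simp [eq_comm (a := x), neg_eq_iff_eq_neg, hne.symm, hax.1, hax.2]
      refine ⟨{x, -x, a * x, -(a * x)}, ?_, ?_⟩
      · rw [← hT, card_eq_sum_ones]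
        refine sum_le_sum fun y hy => w_pos y ?_
        simp only [mem_insert, mem_singleton] at hy
        rcases hy with rfl | rfl | rfl | rfl <;> simpa using by assumption
      · intro y hy S hS
        obtain ⟨-, hn, hm⟩ := h0 S hS
        simp only [mem_insert, mem_singleton] at hy
        rcases hy with rfl | rfl | rfl | rfl
        · rfl
        · exact hn _
        · exact hm _
        · exact (hm _).trans (hn _))
  refine ⟨k, hk, ?_⟩
  have hsum : ∑ x, w x + 4 = n + #{x : ZMod n | a * x = x ∨ a * x = -x} +
      2 * #{x : ZMod n | x + x = 0} := by
    have hpt : ∀ x, w x + (if x = 0 then 4 else 0) =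
        1 + (if a * x = x ∨ a * x = -x then 1 else 0) + 2 * (if x + x = 0 then 1 else 0) := by
      intro x
      by_cases hx : x = 0
      · simp [w, hx]
      by_cases hxx : x + x = 0
      · have hax : a * x = x := by
          rcases ZMod.eq_zero_or_eq_half_of_add_self x hxx with h | h
          · exact absurd h hx
          · rcases ZMod.eq_zero_or_eq_half_of_add_self (a * x) (by rw [← mul_add, hxx, mul_zero])
              with h' | h'
            · exact absurd (ha.mul_right_eq_zero.1 h') hx
            · exact h'.1.trans h.1.symm
        simp [w, hx, hxx, hax]
      by_cases hax : a * x = x ∨ a * x = -x <;> simp [w, hx, hxx, hax]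
    have := sum_congr rfl fun x (_ : x ∈ univ) => hpt x
    rw [sum_add_distrib, sum_add_distrib, sum_add_distrib, ← mul_sum, ← card_filter,
      ← card_filter] at this
    simpa [ZMod.card] using this
  have := ZMod.two_mul_card_mul_eq_self_or_neg_le h1 h2
  have := ZMod.card_add_self_eq_zero_le n
  omega


/-- For every positive integer `n`, the number of inverse-closed connection sets
`S ⊆ Z_n \ {0}` (i.e. `S = -S`) that are not multiplier-free (i.e., `aS = S` for
some unit `a ∉ {1, -1}`) is less than `2n · 2^{-n/8} · 2^{⌊n/2⌋}`. -/
theorem stmt10 (n : ℕ) (hn : 0 < n) :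
    ({S : Finset (ZMod n) | (0 : ZMod n) ∉ S ∧ (∀ x : ZMod n, x ∈ S ↔ -x ∈ S) ∧
        ∃ a : ZMod n, IsUnit a ∧ a ≠ 1 ∧ a ≠ -1 ∧
          S.image (fun s => a * s) = S}.ncard : ℝ) <
      2 * (n : ℝ) * (2 : ℝ) ^ (-(n : ℝ) / 8) * 2 ^ (n / 2) := by
  classical
  have : NeZero n := ⟨hn.ne'⟩
  let F : ZMod n → Finset (Finset (ZMod n)) := fun a =>
    if IsUnit a ∧ a ≠ 1 ∧ a ≠ -1 then Finset.univ.filter (fun S : Finset (ZMod n) => 0 ∉ S ∧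
      (∀ x : ZMod n, x ∈ S ↔ -x ∈ S) ∧ S.image (fun s => a * s) = S) else ∅
  set b : ℝ := 2 * (2 : ℝ) ^ (-(n : ℝ) / 8) * 2 ^ (n / 2) with hb
  have hF : ∀ a, ((F a).card : ℝ) < b := by
    intro a
    by_cases ha : IsUnit a ∧ a ≠ 1 ∧ a ≠ -1
    · obtain ⟨k, hk, hkn⟩ := ZMod.exists_card_invariant_le ha.1 ha.2.1 ha.2.2
      simp only [F, if_pos ha]
      calc _ ≤ ((2 ^ k : ℕ) : ℝ) := by exact_mod_cast hk
        _ = (2 : ℝ) ^ (k : ℝ) := by simp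
        _ < (2 : ℝ) ^ (1 + -(n : ℝ) / 8 + (n / 2 : ℕ)) := by
          refine Real.rpow_lt_rpow_of_exponent_lt one_lt_two ?_
          have : (8 * k + n : ℝ) < 8 + 8 * (n / 2 : ℕ) := by exact_mod_cast hkn
          linarith
        _ = b := by
          rw [hb, Real.rpow_add two_pos, Real.rpow_add two_pos, Real.rpow_one, Real.rpow_natCast]
    · simp only [F, if_neg ha, Finset.card_empty, Nat.cast_zero]
      positivity
  calc _ ≤ (((Finset.univ.biUnion F).card : ℕ) : ℝ) := by
        rw [← Set.ncard_coe_finset]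
        refine Nat.cast_le.2 (Set.ncard_le_ncard ?_ (Finset.finite_toSet _))
        rintro S ⟨h0, hS, a, ha, h1, h2, haS⟩
        simp only [Finset.coe_biUnion, Finset.coe_univ, Set.mem_univ, Set.iUnion_true,
          Set.mem_iUnion, Finset.mem_coe]
        exact ⟨a, by simpa [F, ha, h1, h2, h0, haS] using hS⟩
    _ ≤ ∑ a, ((F a).card : ℝ) := by exact_mod_cast Finset.card_biUnion_le
    _ < ∑ _a : ZMod n, b := Finset.sum_lt_sum_of_nonempty Finset.univ_nonempty fun a _ => hF a
    _ = _ := by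
      rw [Finset.sum_const, Finset.card_univ, ZMod.card, nsmul_eq_mul, hb]
      ring
end
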